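/- ker(F_1^{△◊}) ⊆ ker(F_ω^{△†}): if a filter F on a set X satisfies AF ∈ F_1^{△◊}(Y) (i.e., AF ◊ H for every Fréchet filter H on Y) for every set Y and every A ⊆ X × Y, then F also satisfies AF ∈ F_ω^{△†}(Y) (i.e., AF † G for every strongly Fréchet filter G on Y) for every set Y and every A ⊆ X × Y. -/

import Mathlib

open Filter Set

universe u

/-- Two filters mesh if all their members intersect, i.e. the filter generated by
pairwise intersections (which is `F ⊓ G` in Mathlib's order) is proper. -/
def Mesh {Z : Type u} (F G : Filter Z) : Prop := Filter.NeBot (F ⊓ G)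

/-- The `△` relation: `F △ H` iff whenever `H` meshes `F` there is a proper countably
based filter refining `F ∨ H` (i.e. `≤ F ⊓ H` in Mathlib's order). -/
def Triangle {Z : Type u} (F H : Filter Z) : Prop :=
  Mesh H F → ∃ L : Filter Z, L.NeBot ∧ L.IsCountablyGenerated ∧ L ≤ F ⊓ H

/-- Fréchet filters: `F △ A` for every subset `A`. -/
def Frechet {Z : Type u} (F : Filter Z) : Prop := ∀ A : Set Z, Triangle F (𝓟 A)

/-- Strongly Fréchet filters: `F △ H` for every proper countably based filter `H`. -/
def StronglyFrechet {Z : Type u} (F : Filter Z) : Prop :=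
  ∀ H : Filter Z, H.NeBot → H.IsCountablyGenerated → Triangle F H

/-- The `◊` relation: `F ◊ H` iff whenever `H` meshes `F` there is a countable set
meshing with `F ∨ H` (i.e. `F ⊓ H`). -/
def Diamond {Z : Type u} (F H : Filter Z) : Prop :=
  Mesh H F → ∃ A : Set Z, A.Countable ∧ Mesh (𝓟 A) (F ⊓ H)

/-- The `†` relation on filters: `F † H` iff for every countable family of sets,
each meshing with `F ∨ H` (i.e. `F ⊓ H`), one can pick finite subsets whose union
meshes with `F ∨ H`. -/
def Dagger {Z : Type u} (F H : Filter Z) : Prop :=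
  ∀ A : ℕ → Set Z, (∀ n, Mesh (𝓟 (A n)) (F ⊓ H)) →
    ∃ B : ℕ → Set Z, (∀ n, B n ⊆ A n ∧ (B n).Finite) ∧ Mesh (𝓟 (⋃ n, B n)) (F ⊓ H)

/-- The image filter `AF` of a filter `F` on `X` under a set `A ⊆ X × Y`:
generated by the sets `A(F) = {y | ∃ x ∈ F, (x, y) ∈ A}`. -/
def imgSet {X Y : Type u} (A : Set (X × Y)) (F : Filter X) : Filter Y :=
  ⨅ f ∈ F, 𝓟 {y | ∃ x ∈ f, (x, y) ∈ A}

theorem mem_imgSet {X Y : Type u} {A : Set (X × Y)} {F : Filter X} {s : Set Y} :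
    s ∈ imgSet A F ↔ ∃ f ∈ F, {y | ∃ x ∈ f, (x, y) ∈ A} ⊆ s :=
  mem_lift'_sets (h := fun f => {y | ∃ x ∈ f, (x, y) ∈ A})
    fun _ _ hst _ ⟨x, hx, hxy⟩ => ⟨x, hst hx, hxy⟩

/-- If eventually `P m k` holds for ever larger `m`, such `m` can be chosen tending to
infinity with `k`. -/
theorem exists_tendsto_atTop_eventually {P : ℕ → ℕ → Prop}
    (hP : ∀ n, ∀ᶠ k in atTop, ∃ m ≥ n, P m k) :
    ∃ M : ℕ → ℕ, Tendsto M atTop atTop ∧ ∀ᶠ k in atTop, P (M k) k := by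
  classical
  set N : ℕ → ℕ := fun k => Nat.findGreatest (fun n => ∃ m ≥ n, P m k) k
  have hN : ∀ᶠ k in atTop, ∃ m ≥ N k, P m k := by
    filter_upwards [hP 0] with k hk
    exact Nat.findGreatest_spec (P := fun n => ∃ m ≥ n, P m k) (Nat.zero_le k) hk
  have hNt : Tendsto N atTop atTop := by
    refine tendsto_atTop.2 fun n => ?_
    filter_upwards [hP n, eventually_ge_atTop n] with k hk hnk
    exact Nat.le_findGreatest hnk hk
  have hM : ∀ k, ∃ m ≥ N k, (∃ m ≥ N k, P m k) → P m k := fun k => by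
    by_cases hk : ∃ m ≥ N k, P m k
    · obtain ⟨m, hm, hPm⟩ := hk
      exact ⟨m, hm, fun _ => hPm⟩
    · exact ⟨N k, le_rfl, fun h => absurd h hk⟩
  choose M hMN hMP using hM
  exact ⟨M, tendsto_atTop_mono hMN hNt, hN.mono hMP⟩

/-- Countably many sequences, each of which runs through ever later sets `A n`, are
almost contained in one set obtained by choosing finitely many points of each `A n`. -/
theorem exists_finite_subsets_eventually_mem {Y : Type u} {A : ℕ → Set Y} {τ : ℕ → ℕ → Y} :
    ∃ B : ℕ → Set Y, (∀ n, B n ⊆ A n ∧ (B n).Finite) ∧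
      ∀ i, (∀ n, ∀ᶠ k in atTop, ∃ m ≥ n, τ i k ∈ A m) → ∀ᶠ k in atTop, τ i k ∈ ⋃ n, B n := by
  have hM : ∀ i, ∃ M : ℕ → ℕ, Tendsto M atTop atTop ∧
      ((∀ n, ∀ᶠ k in atTop, ∃ m ≥ n, τ i k ∈ A m) → ∀ᶠ k in atTop, τ i k ∈ A (M k)) := by
    intro i
    by_cases hi : ∀ n, ∀ᶠ k in atTop, ∃ m ≥ n, τ i k ∈ A m
    · obtain ⟨M, hM, hA⟩ := exists_tendsto_atTop_eventually (P := fun m k => τ i k ∈ A m) hi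
      exact ⟨M, hM, fun _ => hA⟩
    · exact ⟨id, tendsto_id, fun h => absurd h hi⟩
  choose M hMt hMA using hM
  refine ⟨fun n => ⋃ i ∈ Iic n, τ i '' {k | M i k = n ∧ τ i k ∈ A n}, fun n => ⟨?_, ?_⟩, ?_⟩
  · simp only [iUnion_subset_iff]
    rintro i - _ ⟨k, hk, rfl⟩
    exact hk.2
  · refine (finite_Iic n).biUnion fun i _ => Finite.image _ ?_
    have hfin : {k | ¬ M i k > n}.Finite := by
      have := (hMt i).eventually_gt_atTop n
      rwa [← Nat.cofinite_eq_atTop, eventually_cofinite] at this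
    exact hfin.subset fun k hk => by simp [hk.1]
  · intro i hi
    filter_upwards [hMA i hi, (hMt i).eventually_ge_atTop i] with k hk hik
    exact mem_iUnion.2 ⟨M i k, mem_biUnion (mem_Iic.2 hik) ⟨k, ⟨rfl, hk⟩, rfl⟩⟩

/-- The sum, over the sequences `t` in `T`, of the cofinite filters on their index sets. -/
def sequenceSum {Y : Type u} (T : Set (ℕ → Y)) : Filter ((ℕ → Y) × ULift.{u} ℕ) :=
  ⨆ t ∈ T, map (fun k => (t, ULift.up k)) atTop

theorem mem_sequenceSum {Y : Type u} {T : Set (ℕ → Y)} {s : Set ((ℕ → Y) × ULift.{u} ℕ)} :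
    s ∈ sequenceSum T ↔ ∀ t ∈ T, ∀ᶠ k in atTop, (t, ULift.up k) ∈ s := by
  simp [sequenceSum, Filter.mem_iSup, Filter.eventually_atTop]

theorem frechet_sequenceSum {Y : Type u} (T : Set (ℕ → Y)) : Frechet (sequenceSum T) := by
  intro S hS
  have : ∃ t ∈ T, ∃ᶠ k in atTop, (t, ULift.up k) ∈ S := by
    by_contra! hcon
    rw [Mesh, inf_comm, inf_principal_neBot_iff] at hS
    obtain ⟨z, hz, hzS⟩ := hS Sᶜ (mem_sequenceSum.2 fun t ht => hcon t ht)
    exact hz hzS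
  obtain ⟨t, ht, htS⟩ := this
  refine ⟨map (fun k => (t, ULift.up k)) atTop ⊓ 𝓟 S, ?_, inferInstance,
    inf_le_inf_right _ (le_iSup₂_of_le t ht le_rfl)⟩
  rw [inf_principal_neBot_iff]
  intro U hU
  obtain ⟨k, hkS, hkU⟩ := (htS.and_eventually hU).exists
  exact ⟨_, hkU, hkS⟩

/-- If `G` is strongly Fréchet and the sets `A n` mesh with `K ⊓ G`, then every member of `K`
contains a sequence converging to `G` and running through ever later sets `A n`. -/
theorem StronglyFrechet.exists_seq {Y : Type u} {G K : Filter Y} (hG : StronglyFrechet G)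
    {A : ℕ → Set Y} (hA : ∀ n, Mesh (𝓟 (A n)) (K ⊓ G)) {s : Set Y} (hs : s ∈ K) :
    ∃ t : ℕ → Y, Tendsto t atTop G ∧ (∀ n, ∀ᶠ k in atTop, ∃ m ≥ n, t k ∈ A m) ∧
      ∀ᶠ k in atTop, t k ∈ s := by
  set A' : ℕ → Set Y := fun n => {y | ∃ m ≥ n, y ∈ A m}
  have hanti : Antitone A' := fun _ _ hab _ ⟨m, hm, hy⟩ => ⟨m, hab.trans hm, hy⟩
  have hne : (⨅ n, 𝓟 (A' n ∩ s) ⊓ G).NeBot := by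
    have : ∀ n, (𝓟 (A' n ∩ s) ⊓ G).NeBot := fun n => by
      refine NeBot.mono (hA n) (le_inf ?_ (inf_le_right.trans inf_le_right))
      rw [← inf_principal]
      exact inf_le_inf (principal_mono.2 fun y hy => ⟨n, le_rfl, hy⟩)
        (inf_le_left.trans (le_principal_iff.2 hs))
    have : Nonempty Y := (this 0).nonempty
    refine iInf_neBot_of_directed (Antitone.directed_ge fun a b hab => ?_) ‹_›
    exact inf_le_inf_right _ (principal_mono.2 (inter_subset_inter_left _ (hanti hab)))
  rw [← iInf_inf] at hne
  obtain ⟨L, hL, hLc, hLle⟩ := hG (⨅ n, 𝓟 (A' n ∩ s)) (hne.mono inf_le_left) inferInstance hne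
  obtain ⟨t, ht⟩ := exists_seq_tendsto L
  have htA : ∀ n, ∀ᶠ k in atTop, t k ∈ A' n ∩ s := fun n =>
    tendsto_principal.1 (ht.mono_right (hLle.trans (inf_le_right.trans (iInf_le _ n))))
  exact ⟨t, ht.mono_right (hLle.trans inf_le_left), fun n => (htA n).mono fun _ h => h.1,
    (htA 0).mono fun _ h => h.2⟩

/-- `ker(F_1^{△◊}) ⊆ ker(F_ω^{△†})`. -/
theorem stmt17 {X : Type u} (F : Filter X)
    (h : ∀ (Y : Type u) (A : Set (X × Y)) (H : Filter Y), Frechet H →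
      Diamond (imgSet A F) H) :
    ∀ (Y : Type u) (A : Set (X × Y)) (G : Filter Y), StronglyFrechet G →
      Dagger (imgSet A F) G := by
  intro Y A G hG S hS
  set T : Set (ℕ → Y) :=
    {t | Tendsto t atTop G ∧ ∀ n, ∀ᶠ k in atTop, ∃ m ≥ n, t k ∈ S m}
  set A' : Set (X × (ℕ → Y) × ULift.{u} ℕ) := {p | (p.1, p.2.1 p.2.2.down) ∈ A}
  have hmesh : Mesh (sequenceSum T) (imgSet A' F) := by
    refine inf_neBot_iff.2 fun {U} hU {V} hV => ?_
    obtain ⟨f, hf, hfV⟩ := mem_imgSet.1 hV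
    obtain ⟨t, htG, htS, htf⟩ := hG.exists_seq hS (mem_imgSet.2 ⟨f, hf, Subset.rfl⟩)
    obtain ⟨k, hkU, hkf⟩ := ((mem_sequenceSum.1 hU t ⟨htG, htS⟩).and htf).exists
    exact ⟨_, hkU, hfV hkf⟩
  obtain ⟨C, hC, hCmesh⟩ := h _ A' _ (frechet_sequenceSum T) hmesh
  have : Nonempty ((ℕ → Y) × ULift.{u} ℕ) := hCmesh.nonempty
  have : Nonempty (ℕ → Y) := this.map Prod.fst
  obtain ⟨τ, hτ⟩ := countable_iff_exists_subset_range.1 (hC.image Prod.fst)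
  obtain ⟨B, hB, hτB⟩ := exists_finite_subsets_eventually_mem (A := S) (τ := τ)
  refine ⟨B, hB, ?_⟩
  rw [Mesh, inf_comm, inf_principal_neBot_iff] at hCmesh ⊢
  intro U hU
  obtain ⟨V, hV, W, hW, rfl⟩ := mem_inf_iff.1 hU
  obtain ⟨f, hf, hfV⟩ := mem_imgSet.1 hV
  have hlarge : {z : (ℕ → Y) × ULift.{u} ℕ |
      z.1 ∈ range τ → z.1 z.2.down ∈ W ∩ ⋃ n, B n} ∈ sequenceSum T := by
    refine mem_sequenceSum.2 fun t ht => ?_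
    by_cases htτ : t ∈ range τ
    · obtain ⟨i, rfl⟩ := htτ
      filter_upwards [ht.1 hW, hτB i ht.2] with k hkW hkB _
      exact ⟨hkW, hkB⟩
    · exact Eventually.of_forall fun k hk => absurd hk htτ
  obtain ⟨z, ⟨hzf, hz⟩, hzC⟩ :=
    hCmesh _ (inter_mem_inf (mem_imgSet.2 ⟨f, hf, Subset.rfl⟩) hlarge)
  obtain ⟨hzW, hzB⟩ := hz (hτ (mem_image_of_mem _ hzC))
  exact ⟨_, ⟨hfV hzf, hzW⟩, hzB⟩
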